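/- arXiv:1702.08237 — 4 statements merged into one kernel-verified Lean document; each statement's English description precedes it below -/
import Mathlib

section
/- Let q ∈ ℂ be nonzero with a fixed square root q^{1/2}, and let A1, A2, A3 ∈ ℂ. There exists a ℂ-algebra isomorphism σ : AW_q(A1,A2,A3) → AW_q(A2,A1,A3) satisfying σ(I1) = I2, σ(I2) = I1 and σ(I3) = I3 + (q^{1/2}+q^{−1/2})·(I2·I1 − I1·I2). -/
noncomputable section

open FreeAlgebra

/-- The defining relations of the Askey–Wilson algebra `AW_q(A1,A2,A3)`, where
`s` denotes the fixed square root `q^{1/2}` of `q = s^2`.  The three generators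
`I1, I2, I3` are the images of `0, 1, 2 : Fin 3`. -/
inductive AWRel (s A1 A2 A3 : ℂ) : FreeAlgebra ℂ (Fin 3) → FreeAlgebra ℂ (Fin 3) → Prop
  | rel1 : AWRel s A1 A2 A3
      (s • (ι ℂ (0 : Fin 3) * ι ℂ (1 : Fin 3)) - s⁻¹ • (ι ℂ (1 : Fin 3) * ι ℂ (0 : Fin 3)))
      (ι ℂ (2 : Fin 3) + algebraMap ℂ (FreeAlgebra ℂ (Fin 3)) A3)
  | rel2 : AWRel s A1 A2 A3
      (s • (ι ℂ (1 : Fin 3) * ι ℂ (2 : Fin 3)) - s⁻¹ • (ι ℂ (2 : Fin 3) * ι ℂ (1 : Fin 3)))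
      (ι ℂ (0 : Fin 3) + algebraMap ℂ (FreeAlgebra ℂ (Fin 3)) A1)
  | rel3 : AWRel s A1 A2 A3
      (s • (ι ℂ (2 : Fin 3) * ι ℂ (0 : Fin 3)) - s⁻¹ • (ι ℂ (0 : Fin 3) * ι ℂ (2 : Fin 3)))
      (ι ℂ (1 : Fin 3) + algebraMap ℂ (FreeAlgebra ℂ (Fin 3)) A2)

/-- The Askey–Wilson algebra `AW_q(A1,A2,A3)` with `q = s^2`, `q^{1/2} = s`. -/
abbrev AW (s A1 A2 A3 : ℂ) : Type := RingQuot (AWRel s A1 A2 A3)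

/-- The generators `I1 = AWgen s A1 A2 A3 0`, `I2 = AWgen s A1 A2 A3 1`,
`I3 = AWgen s A1 A2 A3 2`. -/
noncomputable def AWgen (s A1 A2 A3 : ℂ) (i : Fin 3) : AW s A1 A2 A3 :=
  RingQuot.mkAlgHom ℂ (AWRel s A1 A2 A3) (ι ℂ i)

theorem AWgen_rel (s A1 A2 A3 : ℂ) :
    (s • (AWgen s A1 A2 A3 0 * AWgen s A1 A2 A3 1)
        - s⁻¹ • (AWgen s A1 A2 A3 1 * AWgen s A1 A2 A3 0)
      = AWgen s A1 A2 A3 2 + algebraMap ℂ _ A3) ∧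
    (s • (AWgen s A1 A2 A3 1 * AWgen s A1 A2 A3 2)
        - s⁻¹ • (AWgen s A1 A2 A3 2 * AWgen s A1 A2 A3 1)
      = AWgen s A1 A2 A3 0 + algebraMap ℂ _ A1) ∧
    (s • (AWgen s A1 A2 A3 2 * AWgen s A1 A2 A3 0)
        - s⁻¹ • (AWgen s A1 A2 A3 0 * AWgen s A1 A2 A3 2)
      = AWgen s A1 A2 A3 1 + algebraMap ℂ _ A2) := by
  refine ⟨?_, ?_, ?_⟩
  · simpa [AWgen] using
      RingQuot.mkAlgHom_rel ℂ (AWRel.rel1 (s := s) (A1 := A1) (A2 := A2) (A3 := A3))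
  · simpa [AWgen] using
      RingQuot.mkAlgHom_rel ℂ (AWRel.rel2 (s := s) (A1 := A1) (A2 := A2) (A3 := A3))
  · simpa [AWgen] using
      RingQuot.mkAlgHom_rel ℂ (AWRel.rel3 (s := s) (A1 := A1) (A2 := A2) (A3 := A3))

/-- A triple satisfying the Askey–Wilson relations induces a map out of `AW`. -/
theorem AW_exists_lift {B : Type*} [Ring B] [Algebra ℂ B] (s A1 A2 A3 : ℂ) (x y z : B)
    (h1 : s • (x * y) - s⁻¹ • (y * x) = z + algebraMap ℂ B A3)
    (h2 : s • (y * z) - s⁻¹ • (z * y) = x + algebraMap ℂ B A1)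
    (h3 : s • (z * x) - s⁻¹ • (x * z) = y + algebraMap ℂ B A2) :
    ∃ f : AW s A1 A2 A3 →ₐ[ℂ] B, f (AWgen s A1 A2 A3 0) = x ∧
      f (AWgen s A1 A2 A3 1) = y ∧ f (AWgen s A1 A2 A3 2) = z := by
  refine ⟨RingQuot.liftAlgHom ℂ ⟨FreeAlgebra.lift ℂ ![x, y, z], ?_⟩, ?_, ?_, ?_⟩
  · rintro _ _ (_ | _ | _)
    · simpa using h1
    · simpa using h2
    · simpa using h3
  all_goals simp [AWgen]

theorem AW_algHom_ext {B : Type*} [Ring B] [Algebra ℂ B] {s A1 A2 A3 : ℂ}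
    {f g : AW s A1 A2 A3 →ₐ[ℂ] B} (h : ∀ i, f (AWgen s A1 A2 A3 i) = g (AWgen s A1 A2 A3 i)) :
    f = g := by
  apply RingQuot.ringQuot_ext'
  ext i
  exact h i

/-- Given the first relation, the image of `I3` under `σ` has a simpler expression. -/
theorem sigma_image_eq {B : Type*} [Ring B] [Algebra ℂ B] {s c : ℂ} {x y z : B}
    (h : s • (x * y) - s⁻¹ • (y * x) = z + algebraMap ℂ B c) :
    z + (s + s⁻¹) • (y * x - x * y) = s • (y * x) - s⁻¹ • (x * y) - algebraMap ℂ B c := by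
  rw [eq_sub_of_add_eq h.symm]
  module

theorem AW_exists_sigma_hom (s A1 A2 A3 : ℂ) (hs : s ≠ 0) :
    ∃ f : AW s A1 A2 A3 →ₐ[ℂ] AW s A2 A1 A3,
      f (AWgen s A1 A2 A3 0) = AWgen s A2 A1 A3 1 ∧
      f (AWgen s A1 A2 A3 1) = AWgen s A2 A1 A3 0 ∧
      f (AWgen s A1 A2 A3 2) =
        AWgen s A2 A1 A3 2 +
          (s + s⁻¹) • (AWgen s A2 A1 A3 1 * AWgen s A2 A1 A3 0
            - AWgen s A2 A1 A3 0 * AWgen s A2 A1 A3 1) := by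
  obtain ⟨h1, h2, h3⟩ := AWgen_rel s A2 A1 A3
  have hz := eq_sub_of_add_eq h1.symm
  apply AW_exists_lift <;> rw [sigma_image_eq h1]
  · abel
  · rw [← h3, hz]
    simp only [Algebra.algebraMap_eq_smul_one, mul_sub, sub_mul, mul_smul_comm, smul_mul_assoc,
      mul_one, one_mul, mul_assoc]
    match_scalars <;> field_simp
  · rw [← h2, hz]
    simp only [Algebra.algebraMap_eq_smul_one, mul_sub, sub_mul, mul_smul_comm, smul_mul_assoc,
      mul_one, one_mul, mul_assoc]
    match_scalars <;> field_simp

/-- A homomorphism acting on generators as `σ` is inverted by the one in the other direction. -/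
theorem AW_sigma_comp_sigma {s A1 A2 A3 : ℂ} {f : AW s A1 A2 A3 →ₐ[ℂ] AW s A2 A1 A3}
    {g : AW s A2 A1 A3 →ₐ[ℂ] AW s A1 A2 A3}
    (f0 : f (AWgen s A1 A2 A3 0) = AWgen s A2 A1 A3 1)
    (f1 : f (AWgen s A1 A2 A3 1) = AWgen s A2 A1 A3 0)
    (f2 : f (AWgen s A1 A2 A3 2) = AWgen s A2 A1 A3 2 +
      (s + s⁻¹) • (AWgen s A2 A1 A3 1 * AWgen s A2 A1 A3 0
        - AWgen s A2 A1 A3 0 * AWgen s A2 A1 A3 1))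
    (g0 : g (AWgen s A2 A1 A3 0) = AWgen s A1 A2 A3 1)
    (g1 : g (AWgen s A2 A1 A3 1) = AWgen s A1 A2 A3 0) :
    g.comp f = AlgHom.id ℂ _ := by
  apply AW_algHom_ext
  intro i
  fin_cases i
  · simp [f0, g1]
  · simp [f1, g0]
  · simp only [Fin.reduceFinMk, AlgHom.comp_apply, AlgHom.id_apply]
    rw [f2, sigma_image_eq (AWgen_rel s A2 A1 A3).1]
    simp only [map_sub, map_smul, map_mul, g0, g1, AlgHom.commutes]
    rw [(AWgen_rel s A1 A2 A3).1, add_sub_cancel_right]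

/-- the isomorphism `σ : AW_q(A1,A2,A3) → AW_q(A2,A1,A3)`,
`σ(I1) = I2`, `σ(I2) = I1`, `σ(I3) = I3 + (q^{1/2}+q^{-1/2})·(I2·I1 − I1·I2)`. -/
theorem AW_iso_sigma (s A1 A2 A3 : ℂ) (hs : s ≠ 0) :
    ∃ σ : AW s A1 A2 A3 ≃ₐ[ℂ] AW s A2 A1 A3,
      σ (AWgen s A1 A2 A3 0) = AWgen s A2 A1 A3 1 ∧
      σ (AWgen s A1 A2 A3 1) = AWgen s A2 A1 A3 0 ∧
      σ (AWgen s A1 A2 A3 2) =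
        AWgen s A2 A1 A3 2 +
          (s + s⁻¹) • (AWgen s A2 A1 A3 1 * AWgen s A2 A1 A3 0
            - AWgen s A2 A1 A3 0 * AWgen s A2 A1 A3 1) := by
  obtain ⟨f, f0, f1, f2⟩ := AW_exists_sigma_hom s A1 A2 A3 hs
  obtain ⟨g, g0, g1, g2⟩ := AW_exists_sigma_hom s A2 A1 A3 hs
  exact ⟨AlgEquiv.ofAlgHom f g (AW_sigma_comp_sigma g0 g1 g2 f0 f1)
    (AW_sigma_comp_sigma f0 f1 f2 g0 g1), f0, f1, f2⟩
end
end

section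
/- Let q ∈ ℂ, q ≠ 0, not be a root of unity, and let α ∈ ℂ and j, k ∈ ℤ with j ≠ k. Then: (1) if q^{2α} = −q^l for some l ∈ ℤ, then [α−j]_q = [α−k]_q if and only if j + k = l; (2) conversely, if [α−j]_q = [α−k]_q, then q^{2α} = −q^{j+k}. -/
noncomputable section

/-- `q^λ := exp (λ·L)`, where `L` is a fixed logarithm of `q` (so `q = exp L` and the
fixed square root is `q^{1/2} = exp (L/2) = qp L (1/2)`). -/
def qp (L lam : ℂ) : ℂ := Complex.exp (lam * L)

/-- The `q`-number `[λ]_q = (q^λ − q^{−λ})/(q − q⁻¹)`. -/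
def qn (L lam : ℂ) : ℂ :=
  (qp L lam - qp L (-lam)) / (Complex.exp L - (Complex.exp L)⁻¹)

theorem qp_two_mul (L a : ℂ) : qp L (2 * a) = qp L a ^ 2 := by
  rw [qp, qp, ← Complex.exp_nat_mul]
  congr 1
  push_cast
  ring

theorem qp_sub_intCast (L a : ℂ) (n : ℤ) :
    qp L (a - n) = qp L a / Complex.exp L ^ n := by
  rw [qp, qp, ← Complex.exp_int_mul, ← Complex.exp_sub, sub_mul]

theorem qp_neg (L a : ℂ) : qp L (-a) = (qp L a)⁻¹ := by
  rw [qp, qp, neg_mul, Complex.exp_neg]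

theorem zpow_injective_of_pow_ne_one {K : Type*} [DivisionRing K] {x : K} (hx : x ≠ 0)
    (h : ∀ n : ℕ, 0 < n → x ^ n ≠ 1) : Function.Injective (fun n : ℤ => x ^ n) := by
  intro m n hmn
  by_contra hne
  have hsub : x ^ (m - n) = 1 := by
    rw [zpow_sub₀ hx, div_eq_one_iff_eq (zpow_ne_zero n hx)]
    exact hmn
  refine h (m - n).natAbs (Int.natAbs_pos.mpr (sub_ne_zero.mpr hne)) ?_
  rcases Int.natAbs_eq (m - n) with he | he
  · rw [he, zpow_natCast] at hsub
    exact hsub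
  · rwa [he, zpow_neg, zpow_natCast, inv_eq_one] at hsub

theorem qn_sub_intCast_eq_iff (L : ℂ) (hq : ∀ n : ℕ, 0 < n → Complex.exp L ^ n ≠ 1)
    (a : ℂ) {j k : ℤ} (hjk : j ≠ k) :
    qn L (a - j) = qn L (a - k) ↔ qp L (2 * a) = -(Complex.exp L ^ (j + k)) := by
  have hQ : Complex.exp L ≠ 0 := Complex.exp_ne_zero L
  have hden : Complex.exp L - (Complex.exp L)⁻¹ ≠ 0 := by
    intro h
    refine hq 2 two_pos ?_
    rw [sq]
    nth_rewrite 2 [sub_eq_zero.mp h]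
    exact mul_inv_cancel₀ hQ
  have hxy : Complex.exp L ^ j - Complex.exp L ^ k ≠ 0 :=
    sub_ne_zero.mpr fun h => hjk (zpow_injective_of_pow_ne_one hQ hq h)
  have hx : Complex.exp L ^ j ≠ 0 := zpow_ne_zero j hQ
  have hy : Complex.exp L ^ k ≠ 0 := zpow_ne_zero k hQ
  have ha : qp L a ≠ 0 := Complex.exp_ne_zero _
  rw [qn, qn, div_left_inj' hden, qp_neg, qp_neg, qp_sub_intCast, qp_sub_intCast,
    qp_two_mul, zpow_add₀ hQ]
  generalize Complex.exp L ^ j = x at *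
  generalize Complex.exp L ^ k = y at *
  generalize qp L a = b at *
  have key : (b / x - (b / x)⁻¹) - (b / y - (b / y)⁻¹) =
      -((x - y) * (b ^ 2 + x * y)) / (b * x * y) := by
    field_simp
    ring
  rw [← sub_eq_zero, key, div_eq_zero_iff, neg_eq_zero, mul_eq_zero, eq_neg_iff_add_eq_zero]
  simp [hxy, ha, hx, hy]

/-- for `q` not a root of unity, `α ∈ ℂ` and `j ≠ k` integers:
(1) if `q^{2α} = −q^l` for `l ∈ ℤ`, then `[α−j]_q = [α−k]_q ↔ j + k = l`;
(2) if `[α−j]_q = [α−k]_q`, then `q^{2α} = −q^{j+k}`. -/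
theorem qnum_coincidence (L : ℂ) (hq : ∀ n : ℕ, 0 < n → Complex.exp L ^ n ≠ 1)
    (α : ℂ) (j k : ℤ) (hjk : j ≠ k) :
    (∀ l : ℤ, qp L (2 * α) = -(Complex.exp L ^ l) →
      (qn L (α - (j : ℂ)) = qn L (α - (k : ℂ)) ↔ j + k = l)) ∧
    (qn L (α - (j : ℂ)) = qn L (α - (k : ℂ)) →
      qp L (2 * α) = -(Complex.exp L ^ (j + k))) := by
  refine ⟨fun l hl => ?_, (qn_sub_intCast_eq_iff L hq α hjk).mp⟩
  rw [qn_sub_intCast_eq_iff L hq α hjk, hl, neg_inj]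
  exact (zpow_injective_of_pow_ne_one (Complex.exp_ne_zero L) hq).eq_iff.trans eq_comm
end
end

section
/- Let q ∈ ℂ be nonzero with a fixed square root q^{1/2}, and let A1, A2, A3 ∈ ℂ. The Casimir element C := q²·I1² + I2² + q²·I3² − (q^{5/2} − q^{1/2})·I1·I2·I3 + q(q+1)·A1·I1 + (q+1)·A2·I2 + q(q+1)·A3·I3 lies in the center of AW_q(A1,A2,A3), i.e. C commutes with every element of AW_q(A1,A2,A3). -/
noncomputable section

open FreeAlgebra

/-- The Casimir element
`C = q²·I1² + I2² + q²·I3² − (q^{5/2}−q^{1/2})·I1·I2·I3 + q(q+1)·A1·I1 + (q+1)·A2·I2 + q(q+1)·A3·I3`,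
written with `q = s^2`, `q^{1/2} = s`, `q^{5/2} = s^5`. -/
noncomputable def AWCasimir (s A1 A2 A3 : ℂ) : AW s A1 A2 A3 :=
  s ^ 4 • (AWgen s A1 A2 A3 0 * AWgen s A1 A2 A3 0)
    + AWgen s A1 A2 A3 1 * AWgen s A1 A2 A3 1
    + s ^ 4 • (AWgen s A1 A2 A3 2 * AWgen s A1 A2 A3 2)
    - (s ^ 5 - s) • (AWgen s A1 A2 A3 0 * AWgen s A1 A2 A3 1 * AWgen s A1 A2 A3 2)
    + (s ^ 2 * (s ^ 2 + 1) * A1) • AWgen s A1 A2 A3 0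
    + ((s ^ 2 + 1) * A2) • AWgen s A1 A2 A3 1
    + (s ^ 2 * (s ^ 2 + 1) * A3) • AWgen s A1 A2 A3 2

section Casimir

variable {R : Type*} [Ring R] [Algebra ℂ R] {s A1 A2 A3 : ℂ} {a b c : R}

/-- Three elements satisfying the Askey–Wilson relations commute with the Casimir expression
formed from them. -/
theorem casimir_commute_of_relations (hs : s ≠ 0)
    (h1 : s • (a * b) - s⁻¹ • (b * a) = c + algebraMap ℂ R A3)
    (h2 : s • (b * c) - s⁻¹ • (c * b) = a + algebraMap ℂ R A1)
    (h3 : s • (c * a) - s⁻¹ • (a * c) = b + algebraMap ℂ R A2)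
    {x : R} (hx : x = a ∨ x = b ∨ x = c) :
    Commute (s ^ 4 • (a * a) + b * b + s ^ 4 • (c * c) - (s ^ 5 - s) • (a * b * c)
      + (s ^ 2 * (s ^ 2 + 1) * A1) • a + ((s ^ 2 + 1) * A2) • b
      + (s ^ 2 * (s ^ 2 + 1) * A3) • c) x := by
  rw [Algebra.algebraMap_eq_smul_one] at h1 h2 h3
  -- Rewriting rules that bring every word into the order `a`, `b`, `c`.
  have hba : b * a = s ^ 2 • (a * b) - s • c - (s * A3) • (1 : R) := by
    linear_combination (norm := skip) -s • h1
    match_scalars <;> field_simp <;> ring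
  have hcb : c * b = s ^ 2 • (b * c) - s • a - (s * A1) • (1 : R) := by
    linear_combination (norm := skip) -s • h2
    match_scalars <;> field_simp <;> ring
  have hca : c * a = (s⁻¹ ^ 2) • (a * c) + s⁻¹ • b + (s⁻¹ * A2) • (1 : R) := by
    linear_combination (norm := skip) s⁻¹ • h3
    match_scalars <;> field_simp <;> ring
  have hba' (y : R) : b * (a * y) = s ^ 2 • (a * (b * y)) - s • (c * y) - (s * A3) • y := by
    rw [← mul_assoc, hba]
    simp only [sub_mul, smul_mul_assoc, mul_assoc, one_mul]
  have hcb' (y : R) : c * (b * y) = s ^ 2 • (b * (c * y)) - s • (a * y) - (s * A1) • y := by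
    rw [← mul_assoc, hcb]
    simp only [sub_mul, smul_mul_assoc, mul_assoc, one_mul]
  have hca' (y : R) :
      c * (a * y) = (s⁻¹ ^ 2) • (a * (c * y)) + s⁻¹ • (b * y) + (s⁻¹ * A2) • y := by
    rw [← mul_assoc, hca]
    simp only [add_mul, smul_mul_assoc, mul_assoc, one_mul]
  rw [commute_iff_eq]
  rcases hx with rfl | rfl | rfl <;>
  · simp only [add_mul, sub_mul, mul_add, mul_sub, smul_mul_assoc, mul_smul_comm, mul_assoc,
      mul_one, hba, hcb, hca, hba', hcb', hca']
    match_scalars <;> field_simp <;> ring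

end Casimir

/-- the Casimir element is central in `AW_q(A1,A2,A3)`. -/
theorem AWCasimir_central (s A1 A2 A3 : ℂ) (hs : s ≠ 0) :
    ∀ x : AW s A1 A2 A3, AWCasimir s A1 A2 A3 * x = x * AWCasimir s A1 A2 A3 := by
  set φ := RingQuot.mkAlgHom ℂ (AWRel s A1 A2 A3) with hφ
  have h1 := RingQuot.mkAlgHom_rel ℂ (AWRel.rel1 (s := s) (A1 := A1) (A2 := A2) (A3 := A3))
  have h2 := RingQuot.mkAlgHom_rel ℂ (AWRel.rel2 (s := s) (A1 := A1) (A2 := A2) (A3 := A3))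
  have h3 := RingQuot.mkAlgHom_rel ℂ (AWRel.rel3 (s := s) (A1 := A1) (A2 := A2) (A3 := A3))
  simp only [map_sub, map_add, map_smul, map_mul, AlgHom.commutes] at h1 h2 h3
  intro x
  obtain ⟨y, rfl⟩ := RingQuot.mkAlgHom_surjective ℂ (AWRel s A1 A2 A3) x
  change Commute (AWCasimir s A1 A2 A3) (φ y)
  induction y using FreeAlgebra.induction with
  | grade0 r => rw [AlgHom.commutes]; exact Algebra.commute_algebraMap_right r _
  | grade1 i =>
    refine casimir_commute_of_relations hs h1 h2 h3 ?_
    fin_cases i <;> simp [hφ]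
  | mul u v hu hv => rw [map_mul]; exact hu.mul_right hv
  | add u v hu hv => rw [map_add]; exact hu.add_right hv
end
end

section
/- Let q not be a root of unity and let (I1,I2,I3) be a classical irreducible representation of AW_q(0,0,A3) on a complex vector space of dimension N+1, and let μ ∈ ℂ be such that the eigenvalues of I3 are −i·[μ]_q, …, −i·[μ−N]_q and O_μ annihilates an eigenvector for −i·[μ]_q. Then (q^{(N+1)/2} + q^{−(N+1)/2})·[μ − N/2]_q = −i·(q^{1/2} + q^{−1/2})·A3. -/
noncomputable section

variable {V : Type*} [AddCommGroup V] [Module ℂ V]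

/-- A representation of `AW_q(A1,A2,A3)` on `V`: a triple of endomorphisms satisfying the
Askey–Wilson `q`-commutation relations. -/
def IsAWRep (L A1 A2 A3 : ℂ) (I1 I2 I3 : Module.End ℂ V) : Prop :=
  qp L (1/2) • (I1 * I2) - qp L (-(1/2)) • (I2 * I1) = I3 + A3 • (1 : Module.End ℂ V) ∧
  qp L (1/2) • (I2 * I3) - qp L (-(1/2)) • (I3 * I2) = I1 + A1 • (1 : Module.End ℂ V) ∧
  qp L (1/2) • (I3 * I1) - qp L (-(1/2)) • (I1 * I3) = I2 + A2 • (1 : Module.End ℂ V)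

/-- Irreducibility: the only subspaces invariant under `I1, I2, I3` are `⊥` and `⊤`. -/
def IsIrreducibleRep (I1 I2 I3 : Module.End ℂ V) : Prop :=
  ∀ W : Submodule ℂ V,
    Submodule.map I1 W ≤ W → Submodule.map I2 W ≤ W → Submodule.map I3 W ≤ W →
      W = ⊥ ∨ W = ⊤

/-- Classical: none of `±2/(q−q⁻¹)`, `±1/(q^{1/2}−q^{−1/2})` is an eigenvalue of `I3`. -/
def IsClassicalRep (L : ℂ) (I3 : Module.End ℂ V) : Prop :=
  ∀ ε : ℂ, ε = 1 ∨ ε = -1 →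
    ¬ Module.End.HasEigenvalue I3 (2 * ε / (Complex.exp L - (Complex.exp L)⁻¹)) ∧
    ¬ Module.End.HasEigenvalue I3 (ε / (qp L (1/2) - qp L (-(1/2))))

/-- The raising shift operator `O_λ`.  (When `A1 = A2 = 0` the coefficient of `I3`
vanishes, giving `O_λ = i·I2 + q^{−λ+1/2}·I1` for every `λ`.) -/
def Oop (L A1 A2 lam : ℂ) (I1 I2 I3 : Module.End ℂ V) : Module.End ℂ V :=
  ((-Complex.I * qp L (1/2) * A1 + qp L (-lam) * A2) /
      (qn L lam * (qn L lam - qn L (lam + 1)))) • I3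
    + Complex.I • I2 + qp L (-lam + 1/2) • I1

/-- The lowering shift operator `R_λ`.  (When `A1 = A2 = 0` the coefficient of `I3`
vanishes, giving `R_λ = i·I2 − q^{λ+1/2}·I1` for every `λ`.) -/
def Rop (L A1 A2 lam : ℂ) (I1 I2 I3 : Module.End ℂ V) : Module.End ℂ V :=
  ((-Complex.I * qp L (1/2) * A1 - qp L lam * A2) /
      (qn L lam * (qn L lam - qn L (lam - 1)))) • I3
    + Complex.I • I2 - qp L (lam + 1/2) • I1

/-- If `I3` is diagonal with entries `c`, the `q`-commutation relations make the trace of `I3 + A`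
vanish against any diagonal weight `t` which is balanced along the nonzero entries of `I1`. -/
theorem sum_weight_mul_diag_eq_zero {ι : Type*} [Fintype ι] (a b : Matrix ι ι ℂ) (c t : ι → ℂ)
    (A s : ℂ) (hs : s ≠ 0)
    (hab : ∀ j, s * ∑ k, a j k * b k j - s⁻¹ * ∑ k, b j k * a k j = c j + A)
    (ha : ∀ j k, a j k = (s * c k - s⁻¹ * c j) * b j k)
    (hb : ∀ j k, b j k = (s * c j - s⁻¹ * c k) * a j k)
    (ht : ∀ j k, (s * c k - s⁻¹ * c j) * (s * c j - s⁻¹ * c k) = 1 →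
      t j * ((s ^ 2 + (s ^ 2)⁻¹) * c k - 2 * c j) +
        t k * ((s ^ 2 + (s ^ 2)⁻¹) * c j - 2 * c k) = 0) :
    ∑ j, t j * (c j + A) = 0 := by
  have hsum : ∑ j, t j * (c j + A) =
      ∑ j, ∑ k, a j k * a k j * (t j * ((s ^ 2 + (s ^ 2)⁻¹) * c k - 2 * c j)) := by
    refine Finset.sum_congr rfl fun j _ => ?_
    rw [← hab j, Finset.mul_sum, Finset.mul_sum, ← Finset.sum_sub_distrib, Finset.mul_sum]
    refine Finset.sum_congr rfl fun k _ => ?_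
    rw [hb k j, hb j k]
    field_simp
    ring
  have hswap := hsum
  rw [Finset.sum_comm] at hswap
  have hdouble : ∑ j, t j * (c j + A) + ∑ j, t j * (c j + A) = 0 := by
    nth_rewrite 1 [hsum]
    rw [hswap, ← Finset.sum_add_distrib]
    refine Finset.sum_eq_zero fun j _ => ?_
    rw [← Finset.sum_add_distrib]
    refine Finset.sum_eq_zero fun k _ => ?_
    by_cases h0 : a j k = 0
    · simp [h0]
    · have h1 : (s * c k - s⁻¹ * c j) * (s * c j - s⁻¹ * c k) = 1 := by
        have h2 := ha j k
        rw [hb j k] at h2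
        apply mul_right_cancel₀ h0
        linear_combination -h2
      linear_combination a j k * a k j * ht j k h1
  simpa using hdouble

/-- Products of two members of a geometric progression avoid `-1` and `-q^{±1}` as soon as the
squares of the members do. -/
theorem geometric_mul_ne {q X : ℂ} (hq0 : q ≠ 0) {N : ℕ}
    (hX : ∀ m ≤ N, (X * q⁻¹ ^ m) ^ 2 ≠ -1 ∧ (X * q⁻¹ ^ m) ^ 2 ≠ -q ∧
      (X * q⁻¹ ^ m) ^ 2 ≠ -q⁻¹) {j k : ℕ} (hj : j ≤ N) (hk : k ≤ N) :
    X * q⁻¹ ^ j * (X * q⁻¹ ^ k) ≠ -1 ∧ X * q⁻¹ ^ j * (X * q⁻¹ ^ k) ≠ -q ∧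
      X * q⁻¹ ^ j * (X * q⁻¹ ^ k) ≠ -q⁻¹ := by
  have hprod : X * q⁻¹ ^ j * (X * q⁻¹ ^ k) = X ^ 2 * q⁻¹ ^ (j + k) := by ring
  rcases Nat.even_or_odd' (j + k) with ⟨m, hm | hm⟩
  · have h : X * q⁻¹ ^ j * (X * q⁻¹ ^ k) = (X * q⁻¹ ^ m) ^ 2 := by rw [hprod, hm]; ring
    rw [h]
    exact hX m (by omega)
  · have h : X * q⁻¹ ^ j * (X * q⁻¹ ^ k) = (X * q⁻¹ ^ m) ^ 2 * q⁻¹ := by rw [hprod, hm]; ring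
    have h' : X * q⁻¹ ^ j * (X * q⁻¹ ^ k) = (X * q⁻¹ ^ (m + 1)) ^ 2 * q := by
      rw [h, pow_succ q⁻¹, ← mul_assoc, mul_pow _ q⁻¹ 2]; field_simp
    refine ⟨fun e => (hX m (by omega)).2.1 ?_, fun e => (hX (m + 1) (by omega)).1 ?_,
      fun e => (hX m (by omega)).1 ?_⟩
    · rw [h] at e
      field_simp at e
      linear_combination e
    · rw [h'] at e
      apply mul_right_cancel₀ hq0
      linear_combination e
    · rw [h] at e
      apply mul_right_cancel₀ (inv_ne_zero hq0)
      linear_combination e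

theorem pow_injective_of_pow_ne_one {q : ℂ} (hq0 : q ≠ 0) (hq : ∀ n : ℕ, 0 < n → q ^ n ≠ 1) :
    Function.Injective fun n : ℕ => q ^ n := by
  have main : ∀ j k : ℕ, q ^ j = q ^ k → k ≤ j := by
    intro j k h
    by_contra! hlt
    refine hq (k - j) (by omega) (mul_left_cancel₀ (pow_ne_zero j hq0) ?_)
    rw [← pow_add, mul_one, h]
    congr 1
    omega
  exact fun j k h => le_antisymm (main k j h.symm) (main j k h)

/-- The function `x ↦ -i (x - x⁻¹) / (q - q⁻¹)`, whose value at `q^λ` is `-i[λ]_q`. -/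
def qSpectralValue (q x : ℂ) : ℂ := -Complex.I * ((x - x⁻¹) / (q - q⁻¹))

theorem qSpectralValue_of_sq_eq_neg_one {q x : ℂ} (hx : x ^ 2 = -1) :
    qSpectralValue q x = 2 * (-Complex.I * x) / (q - q⁻¹) := by
  have hinv : x⁻¹ = -x := inv_eq_of_mul_eq_one_right (by linear_combination -hx)
  rw [qSpectralValue, hinv]
  ring

theorem qSpectralValue_of_sq_eq_neg {s x : ℂ} (hs : s ≠ 0) (hs2 : s ^ 2 - (s ^ 2)⁻¹ ≠ 0)
    (hx : x ^ 2 = -s ^ 2) :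
    qSpectralValue (s ^ 2) x = -Complex.I * x * s⁻¹ / (s - s⁻¹) := by
  have hinv : x⁻¹ = -x * (s ^ 2)⁻¹ := inv_eq_of_mul_eq_one_right (by
    field_simp; linear_combination -hx)
  have hfac : s ^ 2 - (s ^ 2)⁻¹ = (s - s⁻¹) * (s + s⁻¹) := by field_simp; ring
  rw [hfac] at hs2
  have h1 := left_ne_zero_of_mul hs2
  have h2 := right_ne_zero_of_mul hs2
  rw [qSpectralValue, hinv, hfac]
  have h3 : x - -x * (s ^ 2)⁻¹ = x * s⁻¹ * (s + s⁻¹) := by field_simp; ring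
  rw [h3, mul_comm (s - s⁻¹), ← mul_div_mul_left _ (s - s⁻¹) h2]
  ring

theorem qSpectralValue_neg_inv (q x : ℂ) : qSpectralValue q (-x⁻¹) = qSpectralValue q x := by
  simp only [qSpectralValue, inv_neg, inv_inv]
  ring

theorem qSpectralValue_eq_iff {q x y : ℂ} (hq : q - q⁻¹ ≠ 0) (hx : x ≠ 0) (hy : y ≠ 0)
    (h : qSpectralValue q x = qSpectralValue q y) : x = y ∨ x * y = -1 := by
  have h1 : x - x⁻¹ = y - y⁻¹ := by
    have := mul_left_cancel₀ (neg_ne_zero.mpr Complex.I_ne_zero) h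
    exact (div_left_inj' hq).mp this
  have h2 : (x - y) * (x * y + 1) = 0 := by
    field_simp at h1
    linear_combination h1
  rcases mul_eq_zero.mp h2 with h3 | h3
  · exact Or.inl (sub_eq_zero.mp h3)
  · exact Or.inr (eq_neg_of_add_eq_zero_left h3)

theorem adjacent_of_qSpectralValue {s x y : ℂ} (hs : s ≠ 0) (hs2 : s ^ 2 - (s ^ 2)⁻¹ ≠ 0)
    (hx : x ≠ 0) (hy : y ≠ 0)
    (h : (s * qSpectralValue (s ^ 2) y - s⁻¹ * qSpectralValue (s ^ 2) x) *
      (s * qSpectralValue (s ^ 2) x - s⁻¹ * qSpectralValue (s ^ 2) y) = 1) :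
    y = s ^ 2 * x ∨ x = s ^ 2 * y ∨ x * y = -s ^ 2 ∨ x * y = -(s ^ 2)⁻¹ := by
  set d := s ^ 2 - (s ^ 2)⁻¹ with hd
  have h1 : -((s * (y - y⁻¹) - s⁻¹ * (x - x⁻¹)) * (s * (x - x⁻¹) - s⁻¹ * (y - y⁻¹))) = d ^ 2 := by
    simp only [qSpectralValue, ← hd] at h
    have hI : ∀ e f : ℂ, (s * (-Complex.I * (e / d)) - s⁻¹ * (-Complex.I * (f / d))) *
        (s * (-Complex.I * (f / d)) - s⁻¹ * (-Complex.I * (e / d))) =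
          -((s * e - s⁻¹ * f) * (s * f - s⁻¹ * e)) / d ^ 2 := fun e f => by
      simp only [div_eq_mul_inv, ← inv_pow]
      linear_combination
        (s * e - s⁻¹ * f) * (s * f - s⁻¹ * e) * d⁻¹ ^ 2 * Complex.I_sq
    rw [hI] at h
    exact (div_eq_one_iff_eq (pow_ne_zero 2 hs2)).mp h
  have h2 : (y - s ^ 2 * x) * (x - s ^ 2 * y) * (x * y + s ^ 2) * (s ^ 2 * (x * y) + 1) = 0 := by
    have h3 : (y - s ^ 2 * x) * (x - s ^ 2 * y) * (x * y + s ^ 2) * (s ^ 2 * (x * y) + 1) =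
        -((s ^ 2) ^ 2 * x ^ 2 * y ^ 2) *
          (-((s * (y - y⁻¹) - s⁻¹ * (x - x⁻¹)) * (s * (x - x⁻¹) - s⁻¹ * (y - y⁻¹))) -
            d ^ 2) := by
      rw [hd]
      field_simp
      ring
    rw [h3, h1, sub_self, mul_zero]
  rcases mul_eq_zero.mp h2 with h3 | h3
  · rcases mul_eq_zero.mp h3 with h3 | h3
    · rcases mul_eq_zero.mp h3 with h3 | h3
      · exact Or.inl (sub_eq_zero.mp h3)
      · exact Or.inr (Or.inl (sub_eq_zero.mp h3))
    · exact Or.inr (Or.inr (Or.inl (eq_neg_of_add_eq_zero_left h3)))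
  · refine Or.inr (Or.inr (Or.inr ?_))
    field_simp
    linear_combination h3

theorem weight_balanced {q x : ℂ} (hq0 : q ≠ 0) (hx : x ≠ 0) :
    (x + x⁻¹) * ((q + q⁻¹) * qSpectralValue q (q * x) - 2 * qSpectralValue q x) +
      (q * x + (q * x)⁻¹) * ((q + q⁻¹) * qSpectralValue q x - 2 * qSpectralValue q (q * x)) = 0 := by
  simp only [qSpectralValue, div_eq_mul_inv]
  generalize (q - q⁻¹)⁻¹ = e
  field_simp
  ring

theorem sum_range_geometric_mul {u : ℂ} (hu : u ≠ 0) (v : ℂ) (n : ℕ) :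
    (∑ j ∈ Finset.range n, v * u ^ n * u⁻¹ * (u ^ 2)⁻¹ ^ j) * (u - u⁻¹) =
      v * (u ^ n - (u ^ n)⁻¹) := by
  have h := geom_sum_mul ((u ^ 2)⁻¹) n
  rw [inv_pow, ← pow_mul, mul_comm 2 n, pow_mul] at h
  have h' : (∑ j ∈ Finset.range n, (u ^ 2)⁻¹ ^ j) * (u - u⁻¹) = u * (1 - ((u ^ n) ^ 2)⁻¹) := by
    field_simp at h ⊢
    linear_combination -h
  rw [← Finset.mul_sum, mul_assoc, h']
  field_simp

/-- Evaluation of the weighted trace by geometric sums. -/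
theorem sum_weight_qSpectralValue {s w : ℂ} (hs : s ≠ 0) (hs2 : s ^ 2 - (s ^ 2)⁻¹ ≠ 0)
    (hw : w ≠ 0) (hw2 : w ^ 2 ≠ -1) (A : ℂ) (n : ℕ) (hn : s ^ n - (s ^ n)⁻¹ ≠ 0)
    (h : ∑ j ∈ Finset.range n, (w * s ^ n * s⁻¹ * (s ^ 2)⁻¹ ^ j +
        (w * s ^ n * s⁻¹ * (s ^ 2)⁻¹ ^ j)⁻¹) *
      (qSpectralValue (s ^ 2) (w * s ^ n * s⁻¹ * (s ^ 2)⁻¹ ^ j) + A) = 0) :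
    (s ^ n + (s ^ n)⁻¹) * ((w - w⁻¹) / (s ^ 2 - (s ^ 2)⁻¹)) =
      -Complex.I * (s + s⁻¹) * A := by
  have hs1 : s - s⁻¹ ≠ 0 := fun h0 => hs2 (by
    rw [← inv_pow, sq_sub_sq, h0, mul_zero])
  have g1 := sum_range_geometric_mul hs w n
  have g2 := sum_range_geometric_mul (inv_ne_zero hs) w⁻¹ n
  have g3 := sum_range_geometric_mul (pow_ne_zero 2 hs) (w ^ 2) n
  have g4 := sum_range_geometric_mul (inv_ne_zero (pow_ne_zero 2 hs)) (w ^ 2)⁻¹ n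
  have hsum : -Complex.I * (s ^ 2 - (s ^ 2)⁻¹)⁻¹ *
        ((∑ j ∈ Finset.range n, w ^ 2 * (s ^ 2) ^ n * (s ^ 2)⁻¹ * ((s ^ 2) ^ 2)⁻¹ ^ j) -
          ∑ j ∈ Finset.range n,
            (w ^ 2)⁻¹ * (s ^ 2)⁻¹ ^ n * (s ^ 2)⁻¹⁻¹ * ((s ^ 2)⁻¹ ^ 2)⁻¹ ^ j) +
      A * ((∑ j ∈ Finset.range n, w * s ^ n * s⁻¹ * (s ^ 2)⁻¹ ^ j) +
          ∑ j ∈ Finset.range n, w⁻¹ * s⁻¹ ^ n * s⁻¹⁻¹ * (s⁻¹ ^ 2)⁻¹ ^ j) = 0 := by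
    rw [← h, ← Finset.sum_sub_distrib, ← Finset.sum_add_distrib, Finset.mul_sum, Finset.mul_sum,
      ← Finset.sum_add_distrib]
    refine Finset.sum_congr rfl fun j _ => ?_
    simp only [qSpectralValue, div_eq_mul_inv]
    simp only [mul_inv, inv_pow, inv_inv]
    ring
  generalize (∑ j ∈ Finset.range n, w * s ^ n * s⁻¹ * (s ^ 2)⁻¹ ^ j) = S1 at *
  generalize (∑ j ∈ Finset.range n, w⁻¹ * s⁻¹ ^ n * s⁻¹⁻¹ * (s⁻¹ ^ 2)⁻¹ ^ j) = S2 at *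
  generalize (∑ j ∈ Finset.range n,
    w ^ 2 * (s ^ 2) ^ n * (s ^ 2)⁻¹ * ((s ^ 2) ^ 2)⁻¹ ^ j) = S3 at *
  generalize (∑ j ∈ Finset.range n,
    (w ^ 2)⁻¹ * (s ^ 2)⁻¹ ^ n * (s ^ 2)⁻¹⁻¹ * ((s ^ 2)⁻¹ ^ 2)⁻¹ ^ j) = S4 at *
  have hz : s ^ n ≠ 0 := pow_ne_zero n hs
  rw [← pow_mul, mul_comm 2 n, pow_mul] at g3
  rw [inv_pow, ← pow_mul, mul_comm 2 n, pow_mul] at g4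
  rw [inv_pow] at g2
  generalize s ^ n = z at *
  have hww : w + w⁻¹ ≠ 0 := fun h0 => hw2 (by field_simp at h0; linear_combination h0)
  have hfac : s ^ 2 - (s ^ 2)⁻¹ = (s - s⁻¹) * (s + s⁻¹) := by rw [← inv_pow]; ring
  set d := s ^ 2 - (s ^ 2)⁻¹ with hd
  apply mul_left_cancel₀ hww
  apply mul_left_cancel₀ hn
  have k1 : (S3 - S4) * d = (w ^ 2 - (w ^ 2)⁻¹) * (z ^ 2 - (z ^ 2)⁻¹) := by
    rw [inv_inv, inv_inv] at g4
    linear_combination g3 + g4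
  have k2 : (S1 + S2) * d = (w + w⁻¹) * (z - z⁻¹) * (s + s⁻¹) := by
    rw [inv_inv, inv_inv] at g2
    rw [hfac]
    linear_combination (s + s⁻¹) * (g1 - g2)
  have k3 : -Complex.I * d⁻¹ * ((S3 - S4) * d) + A * ((S1 + S2) * d) = 0 := by
    linear_combination d * hsum
  rw [k1, k2] at k3
  rw [div_eq_mul_inv]
  rw [← inv_pow, ← inv_pow] at k3
  linear_combination Complex.I * k3 + (w ^ 2 - w⁻¹ ^ 2) * (z ^ 2 - z⁻¹ ^ 2) * d⁻¹ * Complex.I_sq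

/-- for a classical irreducible `(N+1)`-dimensional representation of
`AW_q(0,0,A3)` with `I3`-spectrum `−i[μ]_q, …, −i[μ−N]_q` and `O_μ` killing a
`−i[μ]_q`-eigenvector, one has
`(q^{(N+1)/2} + q^{−(N+1)/2})·[μ−N/2]_q = −i·(q^{1/2}+q^{−1/2})·A3`. -/
theorem trace_condition_A1_A2_zero (L : ℂ)
    (hq : ∀ n : ℕ, 0 < n → Complex.exp L ^ n ≠ 1)
    (A3 : ℂ) {V : Type*} [AddCommGroup V] [Module ℂ V] (N : ℕ)
    (I1 I2 I3 : Module.End ℂ V)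
    (hrep : IsAWRep L 0 0 A3 I1 I2 I3)
    (hirr : IsIrreducibleRep I1 I2 I3)
    (hclass : IsClassicalRep L I3)
    (hdim : Module.finrank ℂ V = N + 1)
    (μ : ℂ)
    (hspec : ∀ c : ℂ, Module.End.HasEigenvalue I3 c ↔
      ∃ j : Fin (N + 1), c = -Complex.I * qn L (μ - (j : ℕ)))
    (hO : ∃ v0 : V, v0 ≠ 0 ∧ I3 v0 = (-Complex.I * qn L μ) • v0 ∧
      Oop L 0 0 μ I1 I2 I3 v0 = 0) :
    (qp L (((N : ℂ) + 1) / 2) + qp L (-(((N : ℂ) + 1) / 2))) * qn L (μ - (N : ℂ) / 2)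
      = -Complex.I * (qp L (1/2) + qp L (-(1/2))) * A3 := by
  set s := qp L (1/2) with hs_def
  have hs : s ≠ 0 := Complex.exp_ne_zero _
  have hsneg : qp L (-(1/2)) = s⁻¹ := by
    rw [hs_def, qp, qp, ← Complex.exp_neg]; congr 1; ring
  have hqs : Complex.exp L = s ^ 2 := by
    rw [hs_def, qp, ← Complex.exp_nat_mul]; congr 1; push_cast; ring
  have hs2 : s ^ 2 - (s ^ 2)⁻¹ ≠ 0 := by
    intro h
    apply hq 2 (by norm_num)
    rw [hqs]
    field_simp at h
    linear_combination h
  have hqn : ∀ lam, -Complex.I * qn L lam = qSpectralValue (s ^ 2) (qp L lam) := by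
    intro lam
    have : qp L (-lam) = (qp L lam)⁻¹ := by
      rw [qp, qp, ← Complex.exp_neg]; congr 1; ring
    rw [qn, qSpectralValue, this, hqs]
  set X := qp L μ with hX_def
  have hX0 : X ≠ 0 := Complex.exp_ne_zero _
  have hqpX : ∀ j : ℕ, qp L (μ - j) = X * (s ^ 2)⁻¹ ^ j := by
    intro j
    rw [hX_def, ← hqs, ← Complex.exp_neg, ← Complex.exp_nat_mul, qp, qp, ← Complex.exp_add]
    congr 1; ring
  have hx0 : ∀ j : ℕ, X * (s ^ 2)⁻¹ ^ j ≠ 0 := fun j =>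
    mul_ne_zero hX0 (pow_ne_zero _ (inv_ne_zero (pow_ne_zero _ hs)))
  simp only [hqn, hqpX] at hspec
  have hsq : ∀ m ≤ N, (X * (s ^ 2)⁻¹ ^ m) ^ 2 ≠ -1 ∧ (X * (s ^ 2)⁻¹ ^ m) ^ 2 ≠ -s ^ 2 ∧
      (X * (s ^ 2)⁻¹ ^ m) ^ 2 ≠ -(s ^ 2)⁻¹ := by
    intro m hm
    have hev : Module.End.HasEigenvalue I3 (qSpectralValue (s ^ 2) (X * (s ^ 2)⁻¹ ^ m)) :=
      (hspec _).mpr ⟨⟨m, by omega⟩, rfl⟩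
    have hne := hx0 m
    generalize X * (s ^ 2)⁻¹ ^ m = x at hev hne
    simp only [IsClassicalRep, ← hs_def, hsneg, hqs] at hclass
    refine ⟨fun h => ?_, fun h => ?_, fun h => ?_⟩
    · rw [qSpectralValue_of_sq_eq_neg_one h] at hev
      refine (hclass (-Complex.I * x) (sq_eq_sq_iff_eq_or_eq_neg.mp ?_)).1 hev
      linear_combination x ^ 2 * Complex.I_sq - h
    · rw [qSpectralValue_of_sq_eq_neg hs hs2 h] at hev
      refine (hclass (-Complex.I * x * s⁻¹) (sq_eq_sq_iff_eq_or_eq_neg.mp ?_)).2 hev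
      field_simp
      linear_combination x ^ 2 * Complex.I_sq - h
    · have h' : (-x⁻¹) ^ 2 = -s ^ 2 := by
        rw [neg_sq, inv_pow, h, inv_neg, inv_inv]
      rw [← qSpectralValue_neg_inv, qSpectralValue_of_sq_eq_neg hs hs2 h'] at hev
      refine (hclass (-Complex.I * -x⁻¹ * s⁻¹) (sq_eq_sq_iff_eq_or_eq_neg.mp ?_)).2 hev
      rw [mul_pow, mul_pow, h']
      field_simp
      linear_combination -Complex.I_sq
  have hmul := fun (j k : Fin (N + 1)) => geometric_mul_ne (pow_ne_zero 2 hs) hsq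
    (Nat.lt_succ_iff.mp j.2) (Nat.lt_succ_iff.mp k.2)
  set c : Fin (N + 1) → ℂ := fun j => qSpectralValue (s ^ 2) (X * (s ^ 2)⁻¹ ^ (j : ℕ)) with hc
  have hinj : Function.Injective c := by
    intro j k hjk
    rcases qSpectralValue_eq_iff hs2 (hx0 j) (hx0 k) hjk with h | h
    · have hpow := inv_injective (by
        simpa only [inv_pow] using mul_left_cancel₀ hX0 h)
      exact Fin.ext (pow_injective_of_pow_ne_one (pow_ne_zero 2 hs) (hqs ▸ hq) hpow)
    · exact absurd h (hmul j k).1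
  have hvec : ∀ j, ∃ v, Module.End.HasEigenvector I3 (c j) v := fun j =>
    ((hspec (c j)).mpr ⟨j, rfl⟩).exists_hasEigenvector
  choose v hv using hvec
  have hli : LinearIndependent ℂ v := Module.End.eigenvectors_linearIndependent' I3 c hinj v hv
  let B := basisOfLinearIndependentOfCardEqFinrank hli (by simp [hdim])
  have hB : ∀ j, I3 (B j) = c j • B j := fun j => by
    simpa [B] using (hv j).apply_eq_smul
  have hI3 : LinearMap.toMatrix B B I3 = Matrix.diagonal c := by
    ext j k
    rw [LinearMap.toMatrix_apply, hB]
    by_cases h : k = j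
    · simp [h]
    · simp [Ne.symm h]
  obtain ⟨r1, r2, r3⟩ := hrep
  rw [hsneg, ← hs_def] at r1 r2 r3
  set a := LinearMap.toMatrix B B I1
  set b := LinearMap.toMatrix B B I2
  have m1 : s • (a * b) - s⁻¹ • (b * a) = Matrix.diagonal c + A3 • (1 : Matrix _ _ ℂ) := by
    have := congrArg (LinearMap.toMatrix B B) r1
    simpa [LinearMap.toMatrix_mul, hI3] using this
  have m2 : s • (b * Matrix.diagonal c) - s⁻¹ • (Matrix.diagonal c * b) = a := by
    have := congrArg (LinearMap.toMatrix B B) r2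
    simpa [LinearMap.toMatrix_mul, hI3] using this
  have m3 : s • (Matrix.diagonal c * a) - s⁻¹ • (a * Matrix.diagonal c) = b := by
    have := congrArg (LinearMap.toMatrix B B) r3
    simpa [LinearMap.toMatrix_mul, hI3] using this
  have hzero := sum_weight_mul_diag_eq_zero a b c
    (fun j => X * (s ^ 2)⁻¹ ^ (j : ℕ) + (X * (s ^ 2)⁻¹ ^ (j : ℕ))⁻¹) A3 s hs
    (fun j => by simpa [Matrix.mul_apply] using congrFun (congrFun m1 j) j)
    (fun j k => by
      have := congrFun (congrFun m2 j) k
      simp at this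
      rw [← this]; ring)
    (fun j k => by
      have := congrFun (congrFun m3 j) k
      simp at this
      rw [← this]; ring)
    (fun j k h => by
      rcases adjacent_of_qSpectralValue hs hs2 (hx0 j) (hx0 k) h with h | h | h | h
      · simp only [hc, h]
        exact weight_balanced (pow_ne_zero 2 hs) (hx0 j)
      · simp only [hc, h]
        rw [add_comm]
        exact weight_balanced (pow_ne_zero 2 hs) (hx0 k)
      · exact absurd h (hmul j k).2.1
      · exact absurd h (hmul j k).2.2)
  have hsN : s ^ (N + 1) = qp L (((N : ℂ) + 1) / 2) := by
    rw [hs_def, qp, qp, ← Complex.exp_nat_mul]; congr 1; push_cast; ring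
  have hsN_neg : qp L (-(((N : ℂ) + 1) / 2)) = (s ^ (N + 1))⁻¹ := by
    rw [hsN, qp, qp, ← Complex.exp_neg]; congr 1; ring
  set w := qp L (μ - (N : ℂ) / 2) with hw_def
  have hw0 : w ≠ 0 := Complex.exp_ne_zero _
  have hXw : X = w * s ^ (N + 1) * s⁻¹ := by
    rw [hsN, ← hsneg, hX_def, hw_def, qp, qp, qp, qp, ← Complex.exp_add, ← Complex.exp_add]
    congr 1; ring
  have hw2 : w ^ 2 ≠ -1 := by
    have h := (hmul 0 (Fin.last N)).1
    simp only [Fin.val_zero, Fin.val_last, pow_zero, mul_one] at h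
    intro hw
    apply h
    rw [hXw, ← hw, inv_pow, ← pow_mul, pow_succ]
    field_simp
    ring
  have hsN_sub : s ^ (N + 1) - (s ^ (N + 1))⁻¹ ≠ 0 := by
    intro h
    apply hq (N + 1) (Nat.succ_pos N)
    have hz : s ^ (N + 1) ≠ 0 := pow_ne_zero _ hs
    rw [hqs, ← pow_mul, mul_comm, pow_mul]
    generalize s ^ (N + 1) = z at h hz
    field_simp at h
    linear_combination h
  have hfinal := sum_weight_qSpectralValue hs hs2 hw0 hw2 A3 (N + 1) hsN_sub (by
    rw [← hXw, Finset.sum_range]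
    exact hzero)
  have hqnw : qn L (μ - (N : ℂ) / 2) = (w - w⁻¹) / (s ^ 2 - (s ^ 2)⁻¹) :=
    mul_left_cancel₀ (neg_ne_zero.mpr Complex.I_ne_zero) (hqn _)
  rw [hsneg, hsN_neg, ← hsN, hqnw]
  exact hfinal
end
end
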